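/- Let k ≥ 2 and let t be an integer with 1 ≤ t ≤ (k-2)(k+1)/2 - 1. Let G be a finite simple graph on n vertices with e(G) ≥ (k-1)n - t, such that ē_G(X) ≥ (k-1)|X| + 1 for every subset X ⊆ V(G) with 1 ≤ |X| ≤ n-k+1. Then for every good set D in G with |D| ≤ n-k+1, the graph G - D contains a non-empty subgraph of minimum degree at least k. -/

import Mathlib

/-- The number of edges of `G` incident with at least one vertex of `X`. -/
def eBar {V : Type*} [Fintype V] [DecidableEq V] (G : SimpleGraph V) [DecidableRel G.Adj]
    (X : Finset V) : ℕ :=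
  (G.edgeFinset.filter (fun e => ∃ v ∈ X, v ∈ e)).card

/-- Good sets in `G` (Definition 2.1): `{v}` is good for any vertex `v` of degree exactly
`k`; a good set may be extended by a vertex of degree at most `k-1` in the complement graph;
the union of two intersecting good sets is good; and the union of two good sets joined by an
edge is good. -/
inductive IsGoodSet {V : Type*} [Fintype V] [DecidableEq V] (k : ℕ) (G : SimpleGraph V)
    [DecidableRel G.Adj] : Finset V → Prop
  | single (v : V) (hv : G.degree v = k) : IsGoodSet k G {v}
  | extend (A : Finset V) (v : V) (hA : IsGoodSet k G A) (hv : v ∉ A)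
      (hdeg : (G.neighborFinset v \ A).card ≤ k - 1) : IsGoodSet k G (insert v A)
  | inter (A B : Finset V) (hA : IsGoodSet k G A) (hB : IsGoodSet k G B)
      (hAB : (A ∩ B).Nonempty) : IsGoodSet k G (A ∪ B)
  | join (A B : Finset V) (hA : IsGoodSet k G A) (hB : IsGoodSet k G B)
      (hedge : ∃ a ∈ A, ∃ b ∈ B, G.Adj a b) : IsGoodSet k G (A ∪ B)

theorem eBar_insert_le {V : Type*} [Fintype V] [DecidableEq V] (G : SimpleGraph V)
    [DecidableRel G.Adj] (A : Finset V) (v : V) :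
    eBar G (insert v A) ≤ eBar G A + (G.neighborFinset v \ A).card := by
  unfold eBar
  have h : (G.edgeFinset.filter (fun e => ∃ u ∈ insert v A, u ∈ e)) ⊆
      (G.edgeFinset.filter (fun e => ∃ u ∈ A, u ∈ e)) ∪
        (G.neighborFinset v \ A).image (fun u => s(v, u)) := by
    intro e
    induction e using Sym2.ind with
    | _ x y =>
      simp only [Finset.mem_filter, Finset.mem_union, Finset.mem_image, Finset.mem_sdiff,
        SimpleGraph.mem_edgeFinset, SimpleGraph.mem_edgeSet, SimpleGraph.mem_neighborFinset,
        Finset.mem_insert, Sym2.mem_iff]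
      rintro ⟨hxy, u, hu, hu'⟩
      by_cases hx : x ∈ A
      · exact Or.inl ⟨hxy, x, hx, Or.inl rfl⟩
      by_cases hy : y ∈ A
      · exact Or.inl ⟨hxy, y, hy, Or.inr rfl⟩
      right
      rcases hu' with rfl | rfl
      · rcases hu with rfl | hu
        · exact ⟨y, ⟨hxy, hy⟩, rfl⟩
        · exact absurd hu hx
      · rcases hu with rfl | hu
        · exact ⟨x, ⟨hxy.symm, hx⟩, Sym2.eq_swap⟩
        · exact absurd hu hy
  calc _ ≤ _ := Finset.card_le_card h
    _ ≤ _ := Finset.card_union_le _ _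
    _ ≤ _ := Nat.add_le_add_left Finset.card_image_le _

theorem eBar_submod {V : Type*} [Fintype V] [DecidableEq V] (G : SimpleGraph V)
    [DecidableRel G.Adj] (A B : Finset V) :
    eBar G (A ∪ B) + eBar G (A ∩ B) ≤ eBar G A + eBar G B := by
  unfold eBar
  rw [← Finset.card_union_add_card_inter (G.edgeFinset.filter (fun e => ∃ u ∈ A, u ∈ e))]
  apply Nat.add_le_add <;> apply Finset.card_le_card
  · intro e
    simp only [Finset.mem_filter, Finset.mem_union]
    grind
  · intro e
    simp only [Finset.mem_filter, Finset.mem_inter]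
    grind

theorem eBar_join {V : Type*} [Fintype V] [DecidableEq V] (G : SimpleGraph V)
    [DecidableRel G.Adj] (A B : Finset V) (h : ∃ a ∈ A, ∃ b ∈ B, G.Adj a b) :
    eBar G (A ∪ B) + 1 ≤ eBar G A + eBar G B := by
  unfold eBar
  obtain ⟨a, ha, b, hb, hab⟩ := h
  rw [← Finset.card_union_add_card_inter (G.edgeFinset.filter (fun e => ∃ u ∈ A, u ∈ e))]
  apply Nat.add_le_add
  · apply Finset.card_le_card
    intro e
    simp only [Finset.mem_filter, Finset.mem_union]
    grind
  · apply Finset.card_pos.mpr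
    refine ⟨s(a, b), ?_⟩
    simp only [Finset.mem_filter, Finset.mem_inter, SimpleGraph.mem_edgeFinset,
      SimpleGraph.mem_edgeSet, Sym2.mem_iff]
    exact ⟨⟨hab, a, ha, Or.inl rfl⟩, ⟨hab, b, hb, Or.inr rfl⟩⟩

theorem edges_le_eBar_choose {V : Type*} [Fintype V] [DecidableEq V] (G : SimpleGraph V)
    [DecidableRel G.Adj] (m : ℕ) : ∀ A : Finset V, Aᶜ.card = m →
    G.edgeFinset.card ≤ eBar G A + m.choose 2 := by
  induction m with
  | zero =>
    intro A hA
    have : A = Finset.univ := by simpa using hA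
    subst this
    unfold eBar
    rw [Finset.filter_true_of_mem]
    · simp
    · intro e _
      induction e using Sym2.ind with
      | _ x y => exact ⟨x, Finset.mem_univ _, by simp⟩
  | succ m ih =>
    intro A hA
    obtain ⟨v, hv⟩ : Aᶜ.Nonempty := Finset.card_pos.mp (by omega)
    have h1 : (insert v A)ᶜ.card = m := by
      rw [Finset.compl_insert, Finset.card_erase_of_mem hv]; omega
    have h2 := ih _ h1
    have h3 := eBar_insert_le G A v
    have h4 : (G.neighborFinset v \ A).card ≤ m := by
      rw [← h1]
      apply Finset.card_le_card
      intro u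
      simp only [Finset.mem_sdiff, SimpleGraph.mem_neighborFinset, Finset.mem_compl,
        Finset.mem_insert, not_or]
      rintro ⟨ha, hb⟩
      exact ⟨ha.ne', hb⟩
    have h5 : (m + 1).choose 2 = m + m.choose 2 := by
      rw [Nat.choose_succ_succ' m 1]; simp
    omega

theorem edges_le_of_degenerate {V : Type*} [Fintype V] [DecidableEq V] (G : SimpleGraph V)
    [DecidableRel G.Adj] (j d : ℕ) : ∀ A : Finset V, Aᶜ.card = j + d →
    (∀ s : Finset V, s.Nonempty → Disjoint s A →
      ∃ v ∈ s, (s.filter (fun u => G.Adj v u)).card ≤ j) →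
    G.edgeFinset.card ≤ eBar G A + j.choose 2 + j * d := by
  induction d with
  | zero =>
    intro A hA _
    exact edges_le_eBar_choose G j A hA
  | succ d ih =>
    intro A hA hs
    obtain ⟨v, hv, hdeg⟩ := hs Aᶜ (Finset.card_pos.mp (by omega)) disjoint_compl_left
    have h1 : (insert v A)ᶜ.card = j + d := by
      rw [Finset.compl_insert, Finset.card_erase_of_mem hv]; omega
    have h2 := ih _ h1 (fun s hne hd =>
      hs s hne (hd.mono_right (Finset.subset_insert v A)))
    have h3 := eBar_insert_le G A v
    have h4 : (G.neighborFinset v \ A).card ≤ j := by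
      refine le_trans (Finset.card_le_card ?_) hdeg
      intro u
      simp only [Finset.mem_sdiff, SimpleGraph.mem_neighborFinset, Finset.mem_compl,
        Finset.mem_filter]
      tauto
    rw [Nat.mul_succ]
    omega

theorem eBar_goodSet_le {V : Type*} [Fintype V] [DecidableEq V]
    (k n : ℕ) (hk : 2 ≤ k) (G : SimpleGraph V) [DecidableRel G.Adj]
    (hX : ∀ X : Finset V, X.Nonempty → X.card + k ≤ n + 1 →
        (k - 1) * X.card + 1 ≤ eBar G X) (D : Finset V) (hD : IsGoodSet k G D) :
    D.card + k ≤ n + 1 → eBar G D ≤ (k - 1) * D.card + 1 := by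
  induction hD with
  | single v hv =>
    intro _
    have h := eBar_insert_le G ∅ v
    have h0 : eBar G ∅ = 0 := by simp [eBar]
    rw [h0] at h
    simp only [Finset.sdiff_empty, SimpleGraph.card_neighborFinset_eq_degree, hv] at h
    simp only [Finset.card_singleton]
    have : eBar G {v} ≤ 0 + k := h
    omega
  | extend A v hA hv hdeg ih =>
    intro hc
    rw [Finset.card_insert_of_notMem hv] at hc ⊢
    have := eBar_insert_le G A v
    have := ih (by omega)
    rw [Nat.mul_succ]
    omega
  | inter A B hA hB hAB ihA ihB =>
    intro hc
    have h1 := Finset.card_le_card (Finset.subset_union_left (s₁ := A) (s₂ := B))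
    have h2 := Finset.card_le_card (Finset.subset_union_right (s₁ := A) (s₂ := B))
    have h3 := Finset.card_le_card (Finset.inter_subset_left (s₁ := A) (s₂ := B))
    have h4 := eBar_submod G A B
    have h5 := hX _ hAB (by omega)
    have h6 := ihA (by omega)
    have h7 := ihB (by omega)
    have h8 := congrArg (fun x => (k - 1) * x) (Finset.card_union_add_card_inter A B)
    simp only [Nat.mul_add] at h8
    omega
  | join A B hA hB hedge ihA ihB =>
    intro hc
    have h1 := Finset.card_le_card (Finset.subset_union_left (s₁ := A) (s₂ := B))
    have h2 := Finset.card_le_card (Finset.subset_union_right (s₁ := A) (s₂ := B))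
    have h3 := Finset.card_le_card (Finset.inter_subset_left (s₁ := A) (s₂ := B))
    have h6 := ihA (by omega)
    have h7 := ihB (by omega)
    have h8 := congrArg (fun x => (k - 1) * x) (Finset.card_union_add_card_inter A B)
    simp only [Nat.mul_add] at h8
    by_cases hAB : (A ∩ B).Nonempty
    · have h4 := eBar_submod G A B
      have h5 := hX _ hAB (by omega)
      omega
    · have h4 := eBar_join G A B hedge
      rw [Finset.not_nonempty_iff_eq_empty] at hAB
      rw [hAB] at h8
      simp only [Finset.card_empty, Nat.mul_zero] at h8
      omega

/-- Let `1 ≤ t ≤ (k-2)(k+1)/2 - 1` and let `G` have `n` vertices and at least `(k-1)n - t`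
edges, such that `ē_G(X) ≥ (k-1)|X| + 1` for all non-empty `X` with `|X| ≤ n-k+1`. Then for
every good set `D` with `|D| ≤ n-k+1`, the graph `G - D` contains a non-empty subgraph of
minimum degree at least `k`. -/
theorem remove_goodSet_min_degree_subgraph {V : Type*} [Fintype V] [DecidableEq V]
    (k t n : ℕ) (hk : 2 ≤ k) (ht1 : 1 ≤ t) (ht2 : t ≤ (k - 2) * (k + 1) / 2 - 1)
    (G : SimpleGraph V) [DecidableRel G.Adj]
    (hn : Fintype.card V = n)
    (he : (k - 1) * n ≤ G.edgeFinset.card + t)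
    (hX : ∀ X : Finset V, X.Nonempty → X.card + k ≤ n + 1 →
        (k - 1) * X.card + 1 ≤ eBar G X) :
    ∀ D : Finset V, IsGoodSet k G D → D.card + k ≤ n + 1 →
      ∃ s : Finset V, s.Nonempty ∧ Disjoint s D ∧
        ∀ v ∈ s, k ≤ (s.filter (fun u => G.Adj v u)).card := by
  intro D hD hc
  by_contra hcon
  push Not at hcon
  have hub := eBar_goodSet_le k n hk G hX D hD hc
  obtain ⟨j, rfl⟩ : ∃ j, k = j + 2 := ⟨k - 2, by omega⟩
  have hcard : Dᶜ.card = n - D.card := by rw [Finset.card_compl, hn]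
  obtain ⟨d, hd⟩ : ∃ d, n = D.card + (j + 1) + d := ⟨n - D.card - (j + 1), by omega⟩
  have hdeg := edges_le_of_degenerate G (j + 1) d D (by omega) (fun s hs hsd => by
    obtain ⟨v, hv, hlt⟩ := hcon s hs hsd
    exact ⟨v, hv, by omega⟩)
  have e1 : j + 2 - 1 = j + 1 := by omega
  have e2 : j + 2 - 2 = j := by omega
  rw [e1] at he hub
  rw [e2] at ht2
  have hch : (j + 1).choose 2 = (j + 1) * j / 2 := by
    rw [Nat.choose_two_right]; simp
  have ht3 : 2 * (t + 1) ≤ j * (j + 2 + 1) := by omega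
  have hch2 : 2 * (j + 1).choose 2 ≤ (j + 1) * j := by omega
  subst hd
  nlinarith
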